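/- arXiv:math/0405381 — 2 statements merged into one kernel-verified Lean document; each statement's English description precedes it below -/
import Mathlib

section
/- Let R be a commutative ring, S a commutative R-algebra such that the structure map R → S is injective, and let d, m be integers with 1 ≤ d < m and gcd(d, m) = 1. Let N := R^m be the standard R-lattice inside the free S-module S^m, and let P be the R-submodule of ⋀^d_S (S^m) generated by the image of ⋀^d_R (R^m). Let f : S^m → S^m be an S-linear automorphism such that the induced automorphism ⋀^d f of ⋀^d_S (S^m) maps P onto P, and such that det f lies in the image of R^× in S. Then f maps N onto N; in particular (taking S = R), an R-linear automorphism f of R^m with ⋀^d f = id and det f = 1 must be the identity. -/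
set_option synthInstance.maxHeartbeats 1000000

namespace IntegralWedge

open ExteriorAlgebra Submodule

section Pow

variable {R S : Type*} [CommRing R] [CommRing S] [Algebra R S]

theorem prod_mem_pow_card {ι : Type*} (L : Submodule R S) (s : Finset ι) (g : ι → S)
    (hg : ∀ i ∈ s, g i ∈ L) : ∏ i ∈ s, g i ∈ L ^ s.card := by
  classical
  induction s using Finset.induction_on with
  | empty => simpa using Submodule.mem_one.2 ⟨(1 : R), map_one (algebraMap R S)⟩
  | insert a s ha ih =>
    rw [Finset.prod_insert ha, Finset.card_insert_of_notMem ha, mul_comm, _root_.pow_succ]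
    exact Submodule.mul_mem_mul (ih fun i hi => hg i (Finset.mem_insert_of_mem hi))
      (hg a (Finset.mem_insert_self _ _))

theorem det_mem_pow {n : ℕ} (L : Submodule R S) (M : Matrix (Fin n) (Fin n) S)
    (hM : ∀ i j, M i j ∈ L) : M.det ∈ L ^ n := by
  rw [Matrix.det_apply]
  refine Submodule.sum_mem _ fun σ _ => ?_
  have h : ∏ i, M (σ i) i ∈ L ^ n := by
    simpa using prod_mem_pow_card L Finset.univ (fun i => M (σ i) i) fun i _ => hM _ _
  rcases Int.units_eq_one_or (Equiv.Perm.sign σ) with hs | hs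
  · simpa [hs] using h
  · simpa [hs] using h

/-- If `L` and `L'` have product inside `R` and their powers of two coprime exponents contain `1`,
then `L` is contained in `R`. -/
theorem le_one_of_one_mem_pow {L L' : Submodule R S} {d m : ℕ} (hgcd : Nat.gcd d m = 1)
    (hLL' : L * L' ≤ 1) (hLd : 1 ∈ L ^ d) (hLm : 1 ∈ L ^ m) (hLd' : 1 ∈ L' ^ d)
    (hLm' : 1 ∈ L' ^ m) : L ≤ 1 := by
  have key : ∀ n, 1 ∈ L ^ n → 1 ∈ L' ^ n → L ^ n = 1 := by
    intro n h h'
    refine le_antisymm ?_ (Submodule.one_le.2 h)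
    calc L ^ n = L ^ n * 1 := (mul_one _).symm
      _ ≤ L ^ n * L' ^ n := mul_le_mul' le_rfl (Submodule.one_le.2 h')
      _ = (L * L') ^ n := (mul_pow _ _ _).symm
      _ ≤ 1 ^ n := pow_le_pow_left' hLL' n
      _ = 1 := one_pow n
  have h : L ^ Nat.gcd d m = 1 := pow_gcd_eq_one.2 ⟨key d hLd hLd', key m hLm hLm'⟩
  rw [hgcd, _root_.pow_one] at h
  exact h.le

end Pow

theorem exists_injective_avoiding {d m : ℕ} (h1d : 1 ≤ d) (hdm : d < m) {i j : Fin m}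
    (hij : i ≠ j) : ∃ I : Fin d → Fin m, Function.Injective I ∧ I ⟨0, h1d⟩ = i ∧ ∀ c, I c ≠ j := by
  set a : Fin m := ⟨0, by omega⟩
  set b : Fin m := ⟨d, hdm⟩
  have hab : b ≠ a := by simp [a, b, Fin.ext_iff]; omega
  set σ : Equiv.Perm (Fin m) := Equiv.swap (Equiv.swap a i b) j * Equiv.swap a i
  have hσa : σ a = i := by
    have h : i ≠ Equiv.swap a i b := by
      intro h
      have := congrArg (Equiv.swap a i) h
      simp at this
      exact hab this.symm
    simp [σ, Equiv.swap_apply_of_ne_of_ne h hij]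
  have hσb : σ b = j := by simp [σ]
  refine ⟨fun c => σ (Fin.castLE hdm.le c), σ.injective.comp (Fin.castLE_injective hdm.le), hσa, ?_⟩
  intro c hc
  have := congrArg Fin.val (σ.injective (hc.trans hσb.symm))
  have h2 := c.2
  simp [b] at this
  omega

section Lattice

variable (R : Type*) {S : Type*} [CommRing R] [CommRing S] [Algebra R S] {d m : ℕ}

variable (S d m) in
/-- The `R`-span of the `d`-fold wedges of vectors of `R^m` in the exterior algebra of `S^m`. -/
def wedges : Submodule R (ExteriorAlgebra S (Fin m → S)) :=
  Submodule.span R {x : ExteriorAlgebra S (Fin m → S) |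
    ∃ v : Fin d → (Fin m → R),
      x = ExteriorAlgebra.ιMulti S d fun i j => algebraMap R S (v i j)}

variable (S) in
/-- The linear form on the exterior algebra reading off the minor with columns `I`. -/
noncomputable def minorForm (I : Fin d → Fin m) :
    ExteriorAlgebra S (Fin m → S) →ₗ[S] S :=
  ExteriorAlgebra.liftAlternating
    (Pi.single d (Matrix.detRowAlternating.compLinearMap (LinearMap.funLeft S S I)))

theorem minorForm_ιMulti (I : Fin d → Fin m) (v : Fin d → Fin m → S) :
    minorForm S I (ιMulti S d v) = Matrix.det (Matrix.of fun b a => v b (I a)) := by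
  simp only [minorForm, liftAlternating_apply_ιMulti, Pi.single_eq_same]
  rfl

variable {R}

theorem ιMulti_mem_wedges (v : Fin d → Fin m → R) :
    ιMulti S d (fun i j => algebraMap R S (v i j)) ∈ wedges R S d m :=
  Submodule.subset_span ⟨v, rfl⟩

theorem minorForm_map_mem_pow (I : Fin d → Fin m) (L : Submodule R S)
    (g : (Fin m → S) →ₗ[S] (Fin m → S))
    (hg : ∀ (v : Fin m → R) j, g (fun i => algebraMap R S (v i)) j ∈ L)
    {x : ExteriorAlgebra S (Fin m → S)} (hx : x ∈ wedges R S d m) :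
    minorForm S I (ExteriorAlgebra.map g x) ∈ L ^ d := by
  suffices wedges R S d m ≤ (L ^ d).comap
      ((minorForm S I ∘ₗ (ExteriorAlgebra.map g).toLinearMap).restrictScalars R) from this hx
  refine Submodule.span_le.2 ?_
  rintro _ ⟨v, rfl⟩
  change minorForm S I (ExteriorAlgebra.map g _) ∈ L ^ d
  rw [map_apply_ιMulti, minorForm_ιMulti]
  exact det_mem_pow L _ fun b a => hg _ _

theorem minorForm_mem_one (I : Fin d → Fin m)
    {x : ExteriorAlgebra S (Fin m → S)} (hx : x ∈ wedges R S d m) :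
    minorForm S I x ∈ (1 : Submodule R S) := by
  have := minorForm_map_mem_pow I (1 : Submodule R S) LinearMap.id
    (fun v j => Submodule.mem_one.2 ⟨v j, rfl⟩) hx
  simpa using this

theorem map_mem_wedges (g : (Fin m → S) →ₗ[S] (Fin m → S)) (g' : (Fin m → R) → (Fin m → R))
    (hg : ∀ v : Fin m → R, g (fun i => algebraMap R S (v i)) = fun i => algebraMap R S (g' v i))
    {x : ExteriorAlgebra S (Fin m → S)} (hx : x ∈ wedges R S d m) :
    ExteriorAlgebra.map g x ∈ wedges R S d m := by
  suffices wedges R S d m ≤ (wedges R S d m).comap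
      ((ExteriorAlgebra.map g).toLinearMap.restrictScalars R) from this hx
  refine Submodule.span_le.2 ?_
  rintro _ ⟨v, rfl⟩
  change ExteriorAlgebra.map g _ ∈ wedges R S d m
  rw [map_apply_ιMulti]
  have : (g ∘ fun i j => algebraMap R S (v i j)) = fun i j => algebraMap R S (g' (v i) j) :=
    funext fun i => hg (v i)
  rw [this]
  exact ιMulti_mem_wedges _

variable (f : (Fin m → S) ≃ₗ[S] (Fin m → S))

/-- Conjugating an elementary transvection by `f` preserves the lattice of wedges, and its minors
compute the sums below. -/
theorem sum_mul_mem_one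
    (hf : ∀ x ∈ wedges R S d m, ExteriorAlgebra.map f.toLinearMap x ∈ wedges R S d m)
    (hf' : ∀ x ∈ wedges R S d m, ExteriorAlgebra.map f.symm.toLinearMap x ∈ wedges R S d m)
    (k l : Fin m) (I : Fin d → Fin m) (v : Fin d → Fin m → R)
    (hv : ∀ b a, v b (I a) = (1 : Matrix (Fin d) (Fin d) R) b a) :
    ∑ a, f.symm (Pi.single k 1) (I a) * f (fun j => algebraMap R S (v a j)) l
      ∈ (1 : Submodule R S) := by
  set t : (Fin m → S) →ₗ[S] (Fin m → S) :=
    LinearMap.id + (LinearMap.proj l).smulRight (Pi.single k 1)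
  have ht : ∀ x ∈ wedges R S d m, ExteriorAlgebra.map t x ∈ wedges R S d m := fun x hx =>
    map_mem_wedges t (fun w => w + w l • Pi.single k 1) (fun w => by
      ext j
      by_cases hj : j = k
      · subst hj; simp [t, Algebra.smul_def]
      · simp [t, hj]) hx
  have h := minorForm_mem_one I (hf' _ (ht _ (hf _ (ιMulti_mem_wedges v))))
  rw [map_apply_ιMulti, map_apply_ιMulti, map_apply_ιMulti, minorForm_ιMulti] at h
  have hM : (Matrix.of fun b a => (f.symm.toLinearMap ∘ t ∘ f.toLinearMap ∘
        fun i j => algebraMap R S (v i j)) b (I a))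
      = 1 + Matrix.replicateCol Unit (fun b => f (fun j => algebraMap R S (v b j)) l)
        * Matrix.replicateRow Unit (fun a => f.symm (Pi.single k 1) (I a)) := by
    ext b a
    have : algebraMap R S (v b (I a)) = (1 : Matrix (Fin d) (Fin d) S) b a := by
      rw [hv, Matrix.one_apply, Matrix.one_apply]
      split_ifs <;> simp
    simp [t, Matrix.mul_apply, this]
  rw [hM, Matrix.det_one_add_replicateCol_mul_replicateRow] at h
  have h1 : (1 : S) ∈ (1 : Submodule R S) := Submodule.mem_one.2 ⟨1, map_one _⟩
  simpa [dotProduct] using Submodule.sub_mem _ h h1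

theorem mul_entry_mem_one (h1d : 1 ≤ d) (hdm : d < m) (hgcd : Nat.gcd d m = 1)
    (hf : ∀ x ∈ wedges R S d m, ExteriorAlgebra.map f.toLinearMap x ∈ wedges R S d m)
    (hf' : ∀ x ∈ wedges R S d m, ExteriorAlgebra.map f.symm.toLinearMap x ∈ wedges R S d m)
    (i j k l : Fin m) :
    f.symm (Pi.single k 1) i * f (Pi.single j 1) l ∈ (1 : Submodule R S) := by
  set x : Fin m → S := f.symm (Pi.single k 1)
  set y : Fin m → S := fun j => f (Pi.single j 1) l
  change x i * y j ∈ _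
  have hsingle : ∀ p : Fin m, (fun q => algebraMap R S ((Pi.single p 1 : Fin m → R) q))
      = Pi.single p 1 := by
    intro p
    ext q
    by_cases hq : q = p
    · subst hq; simp
    · simp [hq]
  have hdiag : ∀ I : Fin d → Fin m, Function.Injective I →
      ∑ a, x (I a) * y (I a) ∈ (1 : Submodule R S) := by
    intro I hI
    have := sum_mul_mem_one f hf hf' k l I (fun a => Pi.single (I a) 1) (fun b a => by
      simp [Matrix.one_apply, Pi.single_apply, hI.eq_iff, eq_comm])
    simpa only [hsingle] using this
  have hoff : ∀ p q, p ≠ q → x p * y q ∈ (1 : Submodule R S) := by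
    intro p q hpq
    obtain ⟨I, hI, hI0, hIq⟩ := exists_injective_avoiding h1d hdm hpq
    set z : Fin d := ⟨0, h1d⟩
    have h := sum_mul_mem_one f hf hf' k l I
      (fun a => Pi.single (I a) 1 + if a = z then Pi.single q 1 else 0) (fun b a => by
        split_ifs <;>
        simp [Matrix.one_apply, Pi.single_apply, hI.eq_iff, eq_comm, (hIq _).symm])
    have he : ∀ a, f (fun j => algebraMap R S
        ((Pi.single (I a) 1 + if a = z then Pi.single q 1 else 0 : Fin m → R) j)) l
        = y (I a) + if a = z then y q else 0 := by
      intro a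
      have : (fun j => algebraMap R S
        ((Pi.single (I a) 1 + if a = z then Pi.single q 1 else 0 : Fin m → R) j))
        = Pi.single (I a) 1 + if a = z then Pi.single q 1 else 0 := by
        rw [← hsingle (I a), ← hsingle q]
        ext j
        split_ifs <;> simp
      rw [this, map_add]
      split_ifs <;> simp [y]
    simp only [he, mul_add, Finset.sum_add_distrib, mul_ite, mul_zero, Finset.sum_ite_eq',
      Finset.mem_univ, if_true] at h
    rw [hI0] at h
    simpa [x] using Submodule.sub_mem _ h (hdiag I hI)
  have hdiff : ∀ p q, x p * y p - x q * y q ∈ (1 : Submodule R S) := by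
    intro p q
    by_cases hpq : p = q
    · simp [hpq]
    obtain ⟨I, hI, hI0, hIq⟩ := exists_injective_avoiding h1d hdm hpq
    set z : Fin d := ⟨0, h1d⟩
    have hJ : Function.Injective (Function.update I z q) := by
      intro a b hab
      by_cases ha : a = z <;> by_cases hb : b = z
      · rw [ha, hb]
      · subst ha
        simp [hb] at hab
        exact absurd hab.symm (hIq b)
      · subst hb
        simp [ha] at hab
        exact absurd hab (hIq a)
      · simpa [ha, hb, hI.eq_iff] using hab
    have h := Submodule.sub_mem _ (hdiag I hI) (hdiag _ hJ)
    rw [← Finset.sum_sub_distrib, Finset.sum_eq_single z] at h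
    · simpa [hI0] using h
    · intro b _ hb
      simp [hb]
    · simp
  by_cases hij : i = j
  swap
  · exact hoff i j hij
  subst hij
  have hmul : ∀ {n : ℕ} (I : Fin n → Fin m), ∑ a, x (I a) * y (I a) ∈ (1 : Submodule R S) →
      n • (x i * y i) ∈ (1 : Submodule R S) := by
    intro n I hI
    have h := Submodule.sub_mem _ hI
      (Submodule.sum_mem _ fun a (_ : a ∈ Finset.univ) => hdiff (I a) i)
    rw [← Finset.sum_sub_distrib] at h
    simpa using h
  have hd := hmul _ (hdiag (Fin.castLE hdm.le) (Fin.castLE_injective hdm.le))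
  have htr : ∑ a, x a * y a = (Pi.single k 1 : Fin m → S) l := by
    have hx : x = ∑ a, x a • (Pi.single a 1 : Fin m → S) := by
      simpa using pi_eq_sum_univ' x
    have := congrArg (fun w => f w l) hx
    simp only [map_sum, map_smul, Finset.sum_apply, Pi.smul_apply, smul_eq_mul] at this
    rw [← this]
    simp [x]
  have hm := hmul id (by
    simp only [id, htr]
    exact Submodule.mem_one.2 ⟨(Pi.single k 1 : Fin m → R) l, congrFun (hsingle k) l⟩)
  have hb := Nat.gcd_eq_gcd_ab d m
  rw [hgcd] at hb
  have hone : x i * y i = Nat.gcdA d m • (d • (x i * y i)) + Nat.gcdB d m • (m • (x i * y i)) := by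
    have hb' := congrArg (Int.cast : ℤ → S) hb
    push_cast at hb'
    simp only [zsmul_eq_mul, nsmul_eq_mul]
    linear_combination (x i * y i) * hb'
  rw [hone]
  exact Submodule.add_mem _ (zsmul_mem hd _) (zsmul_mem hm _)

variable (R) in
/-- The `R`-span of the matrix entries of an endomorphism. -/
def entrySpan (g : (Fin m → S) →ₗ[S] (Fin m → S)) : Submodule R S :=
  Submodule.span R {s | ∃ i j, s = g (Pi.single j 1) i}

theorem apply_mem_entrySpan (g : (Fin m → S) →ₗ[S] (Fin m → S)) (v : Fin m → R) (i : Fin m) :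
    g (fun j => algebraMap R S (v j)) i ∈ entrySpan R g := by
  have hv : (fun j => algebraMap R S (v j))
      = ∑ j, algebraMap R S (v j) • (Pi.single j 1 : Fin m → S) := by
    simpa using pi_eq_sum_univ' fun j => algebraMap R S (v j)
  rw [hv]
  simp only [map_sum, map_smul, Finset.sum_apply, Pi.smul_apply, smul_eq_mul,
    ← Algebra.smul_def]
  exact Submodule.sum_mem _ fun j _ => Submodule.smul_mem _ _ (Submodule.subset_span ⟨i, j, rfl⟩)

theorem one_mem_entrySpan_pow_card (g : (Fin m → S) →ₗ[S] (Fin m → S)) (u : Rˣ)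
    (hu : LinearMap.det g = algebraMap R S u) : 1 ∈ entrySpan R g ^ m := by
  have h : (LinearMap.toMatrix' g).det ∈ entrySpan R g ^ m :=
    det_mem_pow _ _ fun i j => Submodule.subset_span ⟨i, j, by
      simp [LinearMap.toMatrix'_apply]⟩
  rw [LinearMap.det_toMatrix', hu] at h
  have := Submodule.smul_mem _ (↑u⁻¹ : R) h
  rwa [Algebra.smul_def, ← map_mul, Units.inv_mul, map_one] at this

theorem one_mem_entrySpan_pow (hdm : d ≤ m)
    (hf' : ∀ x ∈ wedges R S d m, ExteriorAlgebra.map f.symm.toLinearMap x ∈ wedges R S d m) :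
    1 ∈ entrySpan R f.toLinearMap ^ d := by
  set I : Fin d → Fin m := Fin.castLE hdm
  set v : Fin d → Fin m → R := fun a => Pi.single (I a) 1
  have h := minorForm_map_mem_pow I _ f.toLinearMap
    (apply_mem_entrySpan f.toLinearMap) (hf' _ (ιMulti_mem_wedges v))
  rw [map_apply_ιMulti, map_apply_ιMulti, minorForm_ιMulti] at h
  convert h
  rw [← Matrix.det_one (n := Fin d)]
  congr 1
  ext b a
  have hI : I a = I b ↔ b = a := by
    rw [(Fin.castLE_injective hdm).eq_iff, eq_comm]
  simp [v, Matrix.one_apply, Pi.single_apply, hI]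

theorem exists_algebraMap_eq_apply (h1d : 1 ≤ d) (hdm : d < m) (hgcd : Nat.gcd d m = 1)
    (hf : ∀ x ∈ wedges R S d m, ExteriorAlgebra.map f.toLinearMap x ∈ wedges R S d m)
    (hf' : ∀ x ∈ wedges R S d m, ExteriorAlgebra.map f.symm.toLinearMap x ∈ wedges R S d m)
    (u : Rˣ) (hu : LinearMap.det f.toLinearMap = algebraMap R S u)
    (hu' : LinearMap.det f.symm.toLinearMap = algebraMap R S ↑u⁻¹)
    (v : Fin m → R) :
    ∃ w : Fin m → R, (fun i => algebraMap R S (w i)) = f (fun i => algebraMap R S (v i)) := by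
  have hle : entrySpan R f.toLinearMap ≤ 1 := by
    refine le_one_of_one_mem_pow (L' := entrySpan R f.symm.toLinearMap) hgcd ?_
      (one_mem_entrySpan_pow f hdm.le hf') (one_mem_entrySpan_pow_card _ u hu)
      (one_mem_entrySpan_pow f.symm hdm.le hf) (one_mem_entrySpan_pow_card _ u⁻¹ hu')
    rw [entrySpan, entrySpan, Submodule.span_mul_span, Submodule.span_le]
    rintro _ ⟨_, ⟨l, j, rfl⟩, _, ⟨i, k, rfl⟩, rfl⟩
    have := mul_entry_mem_one f h1d hdm hgcd hf hf' i j k l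
    rw [mul_comm] at this
    exact this
  choose w hw using fun i => Submodule.mem_one.1 (hle (apply_mem_entrySpan f.toLinearMap v i))
  exact ⟨w, funext hw⟩

end Lattice

end IntegralWedge

/-- Let `R → S` be injective, `1 ≤ d < m` with `gcd(d,m) = 1`, let
`N = R^m ⊆ S^m` and let `P` be the `R`-submodule of `⋀^d_S(S^m)` generated by the
image of `⋀^d_R(R^m)` (the `R`-span of the `d`-fold wedges of vectors of `N`,
inside the exterior algebra).  If an `S`-linear automorphism `f` of `S^m` is such
that `⋀^d f` maps `P` onto `P` and `det f` lies in the image of `R^×`, then `f`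
maps `N` onto `N`. -/
theorem stmt_14 (R S : Type*) [CommRing R] [CommRing S] [Algebra R S]
    (hinj : Function.Injective (algebraMap R S))
    (d m : ℕ) (h1d : 1 ≤ d) (hdm : d < m) (hgcd : Nat.gcd d m = 1)
    (f : (Fin m → S) ≃ₗ[S] (Fin m → S))
    (hP : Submodule.map
        ((ExteriorAlgebra.map f.toLinearMap).toLinearMap.restrictScalars R)
        (Submodule.span R {x : ExteriorAlgebra S (Fin m → S) |
          ∃ v : Fin d → (Fin m → R),
            x = ExteriorAlgebra.ιMulti S d fun i j => algebraMap R S (v i j)})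
      = Submodule.span R {x : ExteriorAlgebra S (Fin m → S) |
          ∃ v : Fin d → (Fin m → R),
            x = ExteriorAlgebra.ιMulti S d fun i j => algebraMap R S (v i j)})
    (hdet : ∃ u : Rˣ, LinearMap.det (f.toLinearMap) = algebraMap R S u) :
    Submodule.map (f.toLinearMap.restrictScalars R)
        (LinearMap.range
          (LinearMap.pi fun i : Fin m => (Algebra.linearMap R S).comp (LinearMap.proj i)))
      = LinearMap.range
          (LinearMap.pi fun i : Fin m => (Algebra.linearMap R S).comp (LinearMap.proj i)) := by
  obtain ⟨u, hu⟩ := hdet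
  change Submodule.map _ (IntegralWedge.wedges R S d m) = IntegralWedge.wedges R S d m at hP
  have hf : ∀ x ∈ IntegralWedge.wedges R S d m,
      ExteriorAlgebra.map f.toLinearMap x ∈ IntegralWedge.wedges R S d m := fun x hx =>
    hP.le (Submodule.mem_map_of_mem hx)
  have hf' : ∀ x ∈ IntegralWedge.wedges R S d m,
      ExteriorAlgebra.map f.symm.toLinearMap x ∈ IntegralWedge.wedges R S d m := by
    intro x hx
    obtain ⟨y, hy, rfl⟩ := hP.ge hx
    change ExteriorAlgebra.map f.symm.toLinearMap (ExteriorAlgebra.map f.toLinearMap y) ∈ _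
    rw [← AlgHom.comp_apply, ExteriorAlgebra.map_comp_map]
    simpa using hy
  have hu' : LinearMap.det f.symm.toLinearMap = algebraMap R S ↑u⁻¹ := by
    have h := LinearEquiv.det_symm_mul_det f
    rw [hu] at h
    calc _ = LinearMap.det f.symm.toLinearMap * (algebraMap R S u * algebraMap R S ↑u⁻¹) := by
          rw [← map_mul, Units.mul_inv, map_one, mul_one]
      _ = _ := by rw [← mul_assoc, h, one_mul]
  apply le_antisymm
  · rintro _ ⟨_, ⟨v, rfl⟩, rfl⟩
    exact IntegralWedge.exists_algebraMap_eq_apply f h1d hdm hgcd hf hf' u hu hu' v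
  · rintro _ ⟨v, rfl⟩
    obtain ⟨w, hw⟩ := IntegralWedge.exists_algebraMap_eq_apply f.symm h1d hdm hgcd hf' hf u⁻¹ hu'
      (by simpa using hu) v
    refine ⟨_, ⟨w, rfl⟩, ?_⟩
    exact (congrArg f hw).trans (f.apply_symm_apply _)
end

section
/- Let R be a Dedekind domain with fraction field K, and let A be a finitely generated R-algebra that is flat (equivalently, torsion-free) as an R-module, such that the \bar{K}-algebra \bar{K} ⊗_R A is reduced, where \bar{K} is an algebraic closure of K (i.e., the generic fiber is geometrically reduced). Then A is reduced, and the integral closure of A in its total ring of fractions (the localization of A at its set of nonzerodivisors) is a finitely generated A-module. -/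
set_option synthInstance.maxHeartbeats 1000000

open TensorProduct

theorem algebraicIndependent_of_fiber {R K B ι : Type*} [CommRing R] [IsDedekindDomain R]
    [Field K] [Algebra R K] [IsFractionRing R K] [CommRing B] [IsDomain B] [Algebra R B]
    [FaithfulSMul R B] (p : Ideal R) [p.IsPrime] {y : ι → B}
    (h : AlgebraicIndependent p.ResidueField (fun i ↦ (1 ⊗ₜ y i : p.Fiber B))) :
    AlgebraicIndependent R y := by
  classical
  rw [algebraicIndependent_iff]
  by_contra! ⟨F, hF, hF0⟩
  obtain ⟨j, hj⟩ := MvPolynomial.support_nonempty.mpr hF0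
  obtain ⟨a, ha, k, hk, hak⟩ := Ideal.exist_integer_multiples_notMem (K := K)
    (Ideal.IsPrime.ne_top ‹p.IsPrime›) F.support (fun i ↦ algebraMap R K (F.coeff i)) hj
    (by simpa using hj)
  choose! g hg using ha
  obtain ⟨n, d, hd, rfl⟩ := IsFractionRing.div_surjective (A := R) a
  let G : MvPolynomial ι R := ∑ i ∈ F.support, MvPolynomial.monomial i (g i)
  have hGk : G.coeff k = g k := by
    simp only [G, MvPolynomial.coeff_sum, MvPolynomial.coeff_monomial]
    simp [Finset.sum_ite_eq', hk]
  have hdK : algebraMap R K d ≠ 0 := by simpa using nonZeroDivisors.ne_zero hd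
  have hG : d • G = n • F := by
    conv_rhs => rw [F.as_sum]
    simp only [G, Finset.smul_sum, MvPolynomial.smul_monomial]
    refine Finset.sum_congr rfl fun i hi ↦ ?_
    congr 1
    apply IsFractionRing.injective R K
    simp only [smul_eq_mul, map_mul, hg i hi]
    field_simp
  have hGy : MvPolynomial.aeval y G = 0 := by
    have := congrArg (MvPolynomial.aeval y) hG
    rw [map_smul, map_smul, hF, smul_zero, Algebra.smul_def] at this
    refine (mul_eq_zero.mp this).resolve_left ?_
    simpa using nonZeroDivisors.ne_zero hd
  have hmap : MvPolynomial.map (algebraMap R p.ResidueField) G = 0 := by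
    apply (injective_iff_map_eq_zero _).mp h
    rw [MvPolynomial.aeval_map_algebraMap]
    have := DFunLike.congr_fun (MvPolynomial.comp_aeval y
      (Algebra.TensorProduct.includeRight : B →ₐ[R] p.Fiber B)) G
    rw [AlgHom.comp_apply, hGy, map_zero] at this
    exact this.symm
  have := congrArg (MvPolynomial.coeff k) hmap
  rw [MvPolynomial.coeff_map, hGk, MvPolynomial.coeff_zero, Ideal.algebraMap_residueField_eq_zero] at this
  exact hak ⟨g k, this, hg k hk⟩

theorem AlgebraicIndependent.smul_of_ne_zero {k A ι : Type*} [Field k] [CommRing A] [Algebra k A]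
    {x : ι → A} (hx : AlgebraicIndependent k x) {c : ι → k} (hc : ∀ i, c i ≠ 0) :
    AlgebraicIndependent k (fun i ↦ c i • x i) := by
  let φ : MvPolynomial ι k →ₐ[k] MvPolynomial ι k :=
    MvPolynomial.aeval fun i ↦ c i • MvPolynomial.X i
  let ψ : MvPolynomial ι k →ₐ[k] MvPolynomial ι k :=
    MvPolynomial.aeval fun i ↦ (c i)⁻¹ • MvPolynomial.X i
  have hφ : Function.Injective φ := by
    have : ψ.comp φ = AlgHom.id k _ := by
      ext i : 1
      simp [φ, ψ, hc]
    exact Function.LeftInverse.injective (g := ψ) (fun f ↦ DFunLike.congr_fun this f)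
  have : MvPolynomial.aeval (fun i ↦ c i • x i) = (MvPolynomial.aeval x).comp φ := by
    ext i
    simp [φ]
  rw [AlgebraicIndependent, this, AlgHom.coe_comp]
  exact Function.Injective.comp (show Function.Injective (MvPolynomial.aeval x) from hx) hφ

theorem exists_algebraicIndependent_isIntegral_fiber {R B : Type*} [CommRing R] [CommRing B]
    [Algebra R B] [Algebra.FiniteType R B] (p : Ideal R) [p.IsPrime] [Nontrivial (p.Fiber B)] :
    ∃ (s : ℕ) (y : Fin s → B),
      AlgebraicIndependent p.ResidueField (fun i ↦ (1 ⊗ₜ y i : p.Fiber B)) ∧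
      Algebra.IsIntegral (Algebra.adjoin p.ResidueField
        (Set.range fun i ↦ (1 ⊗ₜ y i : p.Fiber B))) (p.Fiber B) := by
  obtain ⟨s, g, hg, hgi⟩ := exists_integral_inj_algHom_of_fg p.ResidueField (p.Fiber B)
  choose r hr y hy using fun i ↦ Ideal.Fiber.exists_smul_eq_one_tmul p (g (MvPolynomial.X i))
  have hr' (i) : algebraMap R p.ResidueField (r i) ≠ 0 := by simpa using hr i
  have hy' (i) : algebraMap R p.ResidueField (r i) • g (MvPolynomial.X i) = 1 ⊗ₜ y i := by
    rw [← hy, algebraMap_smul]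
  have hx : AlgebraicIndependent p.ResidueField fun i ↦ g (MvPolynomial.X i) := by
    rw [AlgebraicIndependent]
    convert hg
    ext; simp
  refine ⟨s, y, ?_, ⟨fun b ↦ ?_⟩⟩
  · simp only [← hy']
    exact hx.smul_of_ne_zero hr'
  · set S := Algebra.adjoin p.ResidueField (Set.range fun i ↦ (1 ⊗ₜ y i : p.Fiber B))
    have hmem (f) : g f ∈ S := by
      induction f using MvPolynomial.induction_on with
      | C a => rw [← MvPolynomial.algebraMap_eq, AlgHom.commutes]; exact S.algebraMap_mem a
      | add _ _ h1 h2 => rw [map_add]; exact add_mem h1 h2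
      | mul_X f i h => 
        rw [map_mul]
        refine mul_mem h ?_
        have : (algebraMap R p.ResidueField (r i))⁻¹ • (1 ⊗ₜ y i : p.Fiber B) ∈ S :=
          S.smul_mem (Algebra.subset_adjoin ⟨i, rfl⟩) _
        rwa [← hy', inv_smul_smul₀ (hr' i)] at this
    obtain ⟨f, hf, hfb⟩ := hgi b
    refine ⟨f.map (g.toRingHom.codRestrict S hmem), hf.map _, ?_⟩
    rw [Polynomial.eval₂_map]
    exact hfb

theorem isIntegral_adjoin_of_pow {k F ι κ : Type*} [CommRing k] [CommRing F] [Algebra k F]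
    {y : ι → F} {w : κ → F} [Algebra.IsIntegral (Algebra.adjoin k (Set.range y)) F]
    {e : ℕ} (he : 0 < e) (h : ∀ i, y i ^ e ∈ Set.range w) :
    Algebra.IsIntegral (Algebra.adjoin k (Set.range w)) F := by
  set S := Algebra.adjoin k (Set.range w)
  have hle : Algebra.adjoin k (Set.range y) ≤ (integralClosure S F).restrictScalars k := by
    rw [Algebra.adjoin_le_iff]
    rintro _ ⟨i, rfl⟩
    refine IsIntegral.of_pow he ?_
    exact isIntegral_algebraMap (R := S) (x := ⟨y i ^ e, Algebra.subset_adjoin (h i)⟩)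
  refine ⟨fun b ↦ isIntegral_trans (A := integralClosure S F) _ ?_⟩
  obtain ⟨f, hf, hfb⟩ := Algebra.IsIntegral.isIntegral (R := Algebra.adjoin k (Set.range y)) b
  refine ⟨f.map ((algebraMap _ F).codRestrict (integralClosure S F) fun x ↦ hle x.2), hf.map _, ?_⟩
  rw [Polynomial.eval₂_map]
  exact hfb

theorem exists_smul_eq_one_tmul_of_mem_adjoin {R B : Type*} [CommRing R] [CommRing B] [Algebra R B]
    (p : Ideal R) [p.IsPrime] {t : Set B} {x : p.Fiber B}
    (hx : x ∈ Algebra.adjoin p.ResidueField ((fun b : B ↦ (1 ⊗ₜ b : p.Fiber B)) '' t)) :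
    ∃ r : R, r ∉ p ∧ ∃ a ∈ Algebra.adjoin R t, r • x = 1 ⊗ₜ a := by
  induction hx using Algebra.adjoin_induction with
  | mem x hx =>
    obtain ⟨b, hb, rfl⟩ := hx
    exact ⟨1, p.one_notMem, b, Algebra.subset_adjoin hb, one_smul _ _⟩
  | algebraMap c =>
    obtain ⟨⟨n, d⟩, h⟩ := IsLocalization.surj (nonZeroDivisors (R ⧸ p)) c
    obtain ⟨n, rfl⟩ := Ideal.Quotient.mk_surjective n
    obtain ⟨d', hd'⟩ := Ideal.Quotient.mk_surjective d.1
    refine ⟨d', fun h' ↦ nonZeroDivisors.ne_zero d.2 ?_, algebraMap R B n,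
      Subalgebra.algebraMap_mem _ _, ?_⟩
    · rw [← hd']; exact Ideal.Quotient.eq_zero_iff_mem.mpr h'
    · simp only [← hd'] at h
      have h2 : algebraMap R p.ResidueField d' * c = algebraMap R p.ResidueField n := by
        rw [mul_comm]; exact h
      rw [Algebra.TensorProduct.algebraMap_apply, Algebra.algebraMap_self_apply, TensorProduct.smul_tmul',
        Algebra.smul_def, h2, Algebra.algebraMap_eq_smul_one, Algebra.algebraMap_eq_smul_one, TensorProduct.smul_tmul]
  | add x y _ _ hx hy =>
    obtain ⟨r, hr, a, ha, h⟩ := hx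
    obtain ⟨r', hr', a', ha', h'⟩ := hy
    refine ⟨r * r', fun hh ↦ (Ideal.IsPrime.mem_or_mem ‹_› hh).elim hr hr', r' • a + r • a',
      add_mem (Subalgebra.smul_mem _ ha _) (Subalgebra.smul_mem _ ha' _), ?_⟩
    rw [TensorProduct.tmul_add, TensorProduct.tmul_smul, TensorProduct.tmul_smul, ← h, ← h', smul_add,
      smul_smul, smul_smul, mul_comm r']
  | mul x y _ _ hx hy =>
    obtain ⟨r, hr, a, ha, h⟩ := hx
    obtain ⟨r', hr', a', ha', h'⟩ := hy
    refine ⟨r * r', fun hh ↦ (Ideal.IsPrime.mem_or_mem ‹_› hh).elim hr hr', a * a',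
      mul_mem ha ha', ?_⟩
    rw [← smul_mul_smul_comm, h, h', Algebra.TensorProduct.tmul_mul_tmul, one_mul]

theorem quasiFinite_of_isIntegral {S F : Type*} [CommRing S] [CommRing F] [Algebra S F]
    [Algebra.FiniteType S F] [Algebra.IsIntegral S F] : Algebra.QuasiFinite S F :=
  have : Module.Finite S F := Algebra.IsIntegral.finite
  inferInstance

theorem exists_notMem_forall_mem_iff {R B ι : Type*} [CommRing R] [CommRing B] [Algebra R B]
    [Algebra.FiniteType R B] (q : Ideal B) [q.IsPrime] {w : ι → B}
    [Algebra.IsIntegral (Algebra.adjoin (q.under R).ResidueField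
      (Set.range fun i ↦ (1 ⊗ₜ w i : (q.under R).Fiber B))) ((q.under R).Fiber B)] :
    ∃ s : B, s ∉ q ∧ ∀ q' : Ideal B, q'.IsPrime →
      (∀ a ∈ Algebra.adjoin R (Set.range w), a ∈ q' ↔ a ∈ q) → s ∉ q' → q' = q := by
  set p := q.under R
  set S := Algebra.adjoin p.ResidueField (Set.range fun i ↦ (1 ⊗ₜ w i : p.Fiber B)) with hS
  have : Algebra.FiniteType S (p.Fiber B) := .of_restrictScalars_finiteType p.ResidueField _ _
  have : Algebra.QuasiFinite S (p.Fiber B) := quasiFinite_of_isIntegral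
  let P : PrimeSpectrum R := ⟨p, inferInstance⟩
  let e := PrimeSpectrum.preimageEquivFiber R B P
  have he (q' : Ideal B) [q'.IsPrime] (h : q'.under R = p) : ∃ Q : Ideal (p.Fiber B), Q.IsPrime ∧
      ∀ b : B, 1 ⊗ₜ b ∈ Q ↔ b ∈ q' := by
    let x : PrimeSpectrum.comap (algebraMap R B) ⁻¹' {P} := ⟨⟨q', ‹_›⟩, PrimeSpectrum.ext h⟩
    refine ⟨(e x).asIdeal, (e x).2, fun b ↦ ?_⟩
    conv_rhs => rw [show q' = (e.symm (e x)).1.asIdeal by rw [e.symm_apply_apply]]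
    rfl
  obtain ⟨Q, hQ, hQq⟩ := he q rfl
  obtain ⟨x, hxQ, hx⟩ := Ideal.exists_not_mem_forall_mem_of_ne_of_liesOver (Q.under S) Q
  obtain ⟨r, hr, s, hs⟩ := Ideal.Fiber.exists_smul_eq_one_tmul p x
  have hmul (Q' : Ideal (p.Fiber B)) [Q'.IsPrime] {r : R} (hr : r ∉ p) {x} : r • x ∈ Q' ↔ x ∈ Q' := by
    refine ⟨fun h ↦ ?_, fun h ↦ Submodule.smul_of_tower_mem _ _ h⟩
    rw [Algebra.smul_def] at h
    refine (Ideal.IsPrime.mem_or_mem ‹_› h).resolve_left fun h' ↦ hr ?_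
    have : Q'.LiesOver p := inferInstance
    exact (Ideal.mem_of_liesOver Q' p r).mpr h'
  refine ⟨s, fun h ↦ ?_, fun q' hq' h hsq' ↦ ?_⟩
  · rw [← hQq, ← hs, hmul _ hr] at h
    exact hxQ h
  have hq'p : q'.under R = p := by
    ext r
    exact h _ (Subalgebra.algebraMap_mem _ r)
  obtain ⟨Q', hQ', hQq'⟩ := he q' hq'p
  have hQQ : Q' = Q := by
    by_contra hne
    refine hsq' ?_
    rw [← hQq', ← hs, hmul _ hr]
    refine hx Q' hQ' hne ⟨?_⟩
    ext ⟨a, ha⟩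
    have ha' := ha
    rw [hS, show (Set.range fun i ↦ (1 ⊗ₜ w i : p.Fiber B)) = (fun b : B ↦ (1 ⊗ₜ b : p.Fiber B)) '' Set.range w by
      rw [← Set.range_comp]; rfl] at ha'
    obtain ⟨r, hr, b, hb, hab⟩ := exists_smul_eq_one_tmul_of_mem_adjoin p ha'
    change a ∈ Q ↔ a ∈ Q'
    rw [← hmul Q hr, ← hmul Q' hr, hab, hQq, hQq', h b hb]
  ext b
  rw [← hQq, ← hQq', hQQ]

theorem Module.Finite.of_forall_isMaximal_exists_pow_smul_mem {B M : Type*} [CommRing B]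
    [AddCommGroup M] [Module B M]
    (h : ∀ q : Ideal B, q.IsMaximal → ∃ r : B, r ∉ q ∧ ∃ N : Submodule B M, N.FG ∧
      ∀ x : M, ∃ k : ℕ, r ^ k • x ∈ N) : Module.Finite B M := by
  have htop : Ideal.span {r : B | ∃ N : Submodule B M, N.FG ∧
      ∀ x : M, ∃ k : ℕ, r ^ k • x ∈ N} = ⊤ := by
    by_contra hne
    obtain ⟨q, hq, hle⟩ := Ideal.exists_le_maximal _ hne
    obtain ⟨r, hr, hN⟩ := h q hq
    exact hr (hle (Ideal.subset_span hN))
  obtain ⟨t, ht, ht'⟩ := (Ideal.span_eq_top_iff_finite _).mp htop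
  have ht2 (r : B) (hr : r ∈ t) : ∃ N : Submodule B M, N.FG ∧ ∀ x : M, ∃ k : ℕ, r ^ k • x ∈ N :=
    ht hr
  choose! N hNfg hN using ht2
  refine ⟨?_⟩
  have hfg : (⨆ r ∈ t, N r).FG := Submodule.fg_biSup t N hNfg
  convert hfg using 1
  refine (eq_top_iff.mpr fun x _ ↦ ?_).symm
  refine Submodule.mem_of_span_eq_top_of_smul_pow_mem _ _ ht' x fun r ↦ ?_
  obtain ⟨k, hk⟩ := hN r r.2 x
  exact ⟨k, Submodule.mem_iSup_of_mem r.1 (Submodule.mem_iSup_of_mem r.2 hk)⟩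

theorem exists_isIntegral_pow_smul {P B L : Type*} [CommRing P] [CommRing B] [CommRing L]
    [Algebra P B] [Algebra B L] [Algebra P L] [IsScalarTower P B L] {r : B} (hr : IsIntegral P r)
    (hB : ∀ b : B, ∃ m : ℕ, IsIntegral P (r ^ m * b))
    {x : L} (hx : IsIntegral B x) : ∃ m : ℕ, IsIntegral P (r ^ m • x) := by
  obtain ⟨f, hf, hfx⟩ := hx
  choose m hm using hB
  let M := f.support.sup fun i ↦ m (f.coeff i)
  refine ⟨M, ?_⟩
  have hcoeff (i : ℕ) : (f.scaleRoots (r ^ M)).coeff i ∈ integralClosure P B := by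
    rw [Polynomial.coeff_scaleRoots, ← pow_mul]
    by_cases hi : i ∈ f.support
    · rcases (Polynomial.le_natDegree_of_mem_supp i hi).eq_or_lt with h | h
      · rw [h, hf.coeff_natDegree, one_mul]
        exact pow_mem (show r ∈ integralClosure P B from hr) _
      · have h1 : m (f.coeff i) ≤ M := Finset.le_sup (f := fun i ↦ m (f.coeff i)) hi
        have h2 : M ≤ M * (f.natDegree - i) := Nat.le_mul_of_pos_right _ (by omega)
        obtain ⟨c, hc⟩ := Nat.exists_eq_add_of_le (h1.trans h2)
        rw [hc, pow_add, ← mul_assoc, mul_comm (f.coeff i)]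
        exact mul_mem (show _ ∈ integralClosure P B from hm _)
          (pow_mem (show r ∈ integralClosure P B from hr) _)
    · rw [Polynomial.notMem_support_iff.mp hi, zero_mul]
      exact zero_mem _
  have hlift : f.scaleRoots (r ^ M) ∈ Polynomial.lifts (algebraMap (integralClosure P B) B) := by
    rw [Polynomial.lifts_iff_coeff_lifts]
    exact fun i ↦ ⟨⟨_, hcoeff i⟩, rfl⟩
  obtain ⟨g, hg, -, hgm⟩ := Polynomial.lifts_and_natDegree_eq_and_monic hlift
    ((Polynomial.monic_scaleRoots_iff _).mpr hf)
  refine isIntegral_trans (A := integralClosure P B) _ ⟨g, hgm, ?_⟩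
  have := Polynomial.scaleRoots_eval₂_eq_zero (s := r ^ M) _ hfx
  rw [← hg, Polynomial.eval₂_map] at this
  rw [Algebra.smul_def]
  exact this

open Algebra in
theorem exists_fg_of_quasiFiniteAt {P B L : Type*} [CommRing P] [IsDomain P] [IsIntegrallyClosed P]
    [IsNoetherianRing P] [CommRing B] [Algebra P B] [Algebra.FiniteType P B] [Field L] [Algebra B L]
    [Algebra P L] [IsScalarTower P B L] [Algebra (FractionRing P) L]
    [IsScalarTower P (FractionRing P) L] [FiniteDimensional (FractionRing P) L]
    [Algebra.IsSeparable (FractionRing P) L] (q : Ideal B) [q.IsPrime] [QuasiFiniteAt P q] :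
    ∃ r : B, r ∉ q ∧ ∃ N : Submodule B (integralClosure B L), N.FG ∧
      ∀ x : integralClosure B L, ∃ k : ℕ, r ^ k • x ∈ N := by
  obtain ⟨r, hrq, hr, hB⟩ := zariskisMainProperty_iff.mp (ZariskisMainProperty.of_finiteType (R := P) q)
  refine ⟨r, hrq, ?_⟩
  obtain ⟨⟨s, hs⟩⟩ : Module.Finite P (integralClosure P L) :=
    IsIntegralClosure.finite P (FractionRing P) L (integralClosure P L)
  let φ : integralClosure P L →ₗ[P] integralClosure B L :=
    { toFun := fun x ↦ ⟨x.1, x.2.tower_top⟩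
      map_add' := fun _ _ ↦ rfl
      map_smul' := fun _ _ ↦ rfl }
  classical
  refine ⟨Submodule.span B (s.image φ), ⟨_, rfl⟩, fun x ↦ ?_⟩
  obtain ⟨m, hm⟩ := exists_isIntegral_pow_smul hr hB x.2
  refine ⟨m, ?_⟩
  have hmem : φ ⟨_, hm⟩ ∈ Submodule.span P (s.image φ : Set (integralClosure B L)) := by
    rw [Finset.coe_image, ← Submodule.map_span, hs]
    exact ⟨_, trivial, rfl⟩
  exact Submodule.span_le_restrictScalars P B _ hmem
open Algebra in
theorem quasiFiniteAt_of_forall_under_eq {P B : Type*} [CommRing P] [CommRing B] [Algebra P B]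
    [Algebra.FiniteType P B] (q : Ideal B) [q.IsPrime] {s : B} (hs : s ∉ q)
    (h : ∀ q' : Ideal B, q'.IsPrime → q'.under P = q.under P → s ∉ q' → q' = q) :
    QuasiFiniteAt P q := by
  refine QuasiFiniteAt.of_isOpen_singleton_fiber (R := P) ⟨q, ‹_›⟩ ?_
  convert (PrimeSpectrum.basicOpen s).isOpen.preimage continuous_subtype_val using 1
  ext ⟨q', hq'⟩
  refine ⟨fun h' ↦ ?_, fun h' ↦ Subtype.ext (PrimeSpectrum.ext
    (h q'.asIdeal q'.2 (congrArg PrimeSpectrum.asIdeal hq') h'))⟩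
  obtain rfl : q' = _ := congrArg Subtype.val h'
  exact hs

theorem MvPolynomial.isIntegrallyClosed_fin {R : Type*} [CommRing R] [IsDomain R]
    [IsIntegrallyClosed R] (n : ℕ) : IsIntegrallyClosed (MvPolynomial (Fin n) R) := by
  induction n with
  | zero => exact .of_equiv (MvPolynomial.isEmptyRingEquiv R (Fin 0)).symm
  | succ n ih => exact .of_equiv (MvPolynomial.finSuccEquiv R n).symm.toRingEquiv

theorem exists_isIntegral_fiber_pow {R B : Type*} [CommRing R] [IsDedekindDomain R] [CommRing B]
    [IsDomain B] [Algebra R B] [FaithfulSMul R B] [Algebra.FiniteType R B] (p : Ideal R) [p.IsPrime]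
    [Nontrivial (p.Fiber B)] {n e : ℕ} (he : 0 < e) (hn : Algebra.trdeg R B ≤ n) :
    ∃ y : Fin n → B, Algebra.IsIntegral (Algebra.adjoin p.ResidueField
      (Set.range fun i ↦ (1 ⊗ₜ (y i ^ e) : p.Fiber B))) (p.Fiber B) := by
  obtain ⟨s, y, hy, hint⟩ := exists_algebraicIndependent_isIntegral_fiber (B := B) p
  have hs : s ≤ n := by
    have h := (algebraicIndependent_of_fiber (K := FractionRing R) p hy).lift_cardinalMk_le_trdeg
    have := h.trans (Cardinal.lift_le.mpr hn)
    simpa using this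
  refine ⟨fun i ↦ if h : i.1 < s then y ⟨i, h⟩ else 0, ?_⟩
  refine isIntegral_adjoin_of_pow (y := fun i ↦ (1 ⊗ₜ y i : p.Fiber B)) he fun i ↦ ⟨(⟨i.1, i.2.trans_le hs⟩ : Fin n), ?_⟩
  simp [Algebra.TensorProduct.tmul_pow]

theorem MvPolynomial.aeval_sub_aeval_mem {R B ι : Type*} [CommRing R] [CommRing B] [Algebra R B]
    (F : MvPolynomial ι R) {u w : ι → B} {I : Ideal B} (h : ∀ i, u i - w i ∈ I) :
    MvPolynomial.aeval u F - MvPolynomial.aeval w F ∈ I := by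
  rw [← Ideal.Quotient.eq_zero_iff_mem, map_sub, sub_eq_zero]
  have h1 : (Ideal.Quotient.mkₐ R I).comp (MvPolynomial.aeval u) =
      (Ideal.Quotient.mkₐ R I).comp (MvPolynomial.aeval w) := by
    ext i
    simpa [← sub_eq_zero (b := Ideal.Quotient.mk I (w i)), ← map_sub, Ideal.Quotient.eq_zero_iff_mem]
      using h i
  exact DFunLike.congr_fun h1 F

open Algebra in
theorem exists_quasiFiniteAt_adjoin {R B : Type*} [CommRing R] [CommRing B] [IsDomain B]
    [Algebra R B] [Algebra.FiniteType R B] (q : Ideal B) [q.IsPrime] {n : ℕ} (w : Fin n → B)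
    [Algebra.IsIntegral (Algebra.adjoin (q.under R).ResidueField
      (Set.range fun i ↦ (1 ⊗ₜ w i : (q.under R).Fiber B))) ((q.under R).Fiber B)] (z : Fin n → B)
    (hq : q ≠ ⊥) :
    ∃ π ∈ Algebra.adjoin R (Set.range w), π ≠ 0 ∧
      QuasiFiniteAt (Algebra.adjoin R (Set.range fun i ↦ w i + π ^ 2 * z i)) q := by
  obtain ⟨s, hsq, hs⟩ := exists_notMem_forall_mem_iff (R := R) q (w := w)
  obtain ⟨π, hπw, hπq, hπ0⟩ : ∃ π ∈ Algebra.adjoin R (Set.range w), π ∈ q ∧ π ≠ 0 := by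
    by_contra! h
    refine hq (hs ⊥ Ideal.isPrime_bot (fun a ha ↦ ⟨?_, fun haq ↦ h a ha haq⟩) ?_).symm
    · rintro rfl
      exact q.zero_mem
    · rintro rfl
      exact hsq q.zero_mem
  refine ⟨π, hπw, hπ0, ?_⟩
  set u : Fin n → B := fun i ↦ w i + π ^ 2 * z i
  have hu {I : Ideal B} (hI : π ^ 2 ∈ I) (i) : u i - w i ∈ I := by
    simpa [u] using I.mul_mem_right _ hI
  have hmem {F : MvPolynomial (Fin n) R} {I : Ideal B} (hI : π ∈ I) :
      MvPolynomial.aeval u F ∈ I ↔ MvPolynomial.aeval w F ∈ I := by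
    have h := MvPolynomial.aeval_sub_aeval_mem F (hu (I.pow_mem_of_mem hI 2 two_pos))
    exact ⟨fun h' ↦ (Submodule.sub_mem_iff_right I h').mp h, fun h' ↦ (I.sub_mem_iff_left h').mp h⟩
  rw [Algebra.adjoin_range_eq_range_aeval] at hπw
  obtain ⟨F, hF⟩ := hπw
  obtain ⟨c, hc⟩ := Ideal.mem_span_singleton.mp
    (MvPolynomial.aeval_sub_aeval_mem F (hu (Ideal.mem_span_singleton_self (π ^ 2))))
  replace hc : MvPolynomial.aeval u F = π * (1 + π * c) := by
    change MvPolynomial.aeval w F = π at hF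
    linear_combination hc + hF
  have hgq : 1 + π * c ∉ q := fun h ↦
    (Ideal.ne_top_iff_one q).mp ‹q.IsPrime›.ne_top
      ((Submodule.add_mem_iff_left _ (q.mul_mem_right c hπq)).mp h)
  have : Algebra.FiniteType (Algebra.adjoin R (Set.range u)) B :=
    .of_restrictScalars_finiteType R _ _
  refine quasiFiniteAt_of_forall_under_eq q (s := s * (1 + π * c))
    (fun h ↦ (Ideal.IsPrime.mem_or_mem ‹_› h).elim hsq hgq) fun q' hq' h hsg ↦ ?_
  have hP (F : MvPolynomial (Fin n) R) : MvPolynomial.aeval u F ∈ q' ↔ MvPolynomial.aeval u F ∈ q := by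
    have hFu : MvPolynomial.aeval u F ∈ Algebra.adjoin R (Set.range u) := by
      rw [Algebra.adjoin_range_eq_range_aeval]; exact ⟨F, rfl⟩
    exact SetLike.ext_iff.mp h ⟨_, hFu⟩
  have hπq' : π ∈ q' := by
    have := (hP F).mpr (by rw [hc]; exact q.mul_mem_right _ hπq)
    rw [hc] at this
    exact (hq'.mem_or_mem this).resolve_right fun h' ↦ hsg (q'.mul_mem_left _ h')
  refine hs q' hq' (fun a ha ↦ ?_) fun h' ↦ hsg (q'.mul_mem_right _ h')
  rw [Algebra.adjoin_range_eq_range_aeval] at ha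
  obtain ⟨G, rfl⟩ := ha
  change MvPolynomial.aeval w G ∈ q' ↔ MvPolynomial.aeval w G ∈ q
  rw [← hmem hπq', ← hmem hπq, hP]

open Algebra in
theorem isAlgebraic_of_quasiFiniteAt {P B : Type*} [CommRing P] [IsDomain P] [CommRing B]
    [IsDomain B] [Algebra P B] [Algebra.FiniteType P B] (q : Ideal B) [q.IsPrime]
    [QuasiFiniteAt P q] : Algebra.IsAlgebraic P B := by
  obtain ⟨r, hrq, hr, hB⟩ := zariskisMainProperty_iff.mp (ZariskisMainProperty.of_finiteType (R := P) q)
  refine ⟨fun b ↦ ?_⟩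
  obtain ⟨m, hm⟩ := hB b
  have hr0 : r ≠ 0 := fun h ↦ hrq (h ▸ q.zero_mem)
  exact IsAlgebraic.of_mul (mem_nonZeroDivisors_of_ne_zero (pow_ne_zero m hr0)) (hr.pow m).isAlgebraic
    hm.isAlgebraic

theorem Derivation.eq_zero_of_isSeparable {E L M : Type*} [Field E] [Field L] [Algebra E L]
    [Algebra.IsSeparable E L] [AddCommGroup M] [Module L M] (d : Derivation ℤ L M)
    (hd : ∀ x : E, d (algebraMap E L x) = 0) : d = 0 := by
  let _ : Module E M := Module.compHom M (algebraMap E L)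
  have : IsScalarTower E L M := ⟨fun e l m ↦ by
    rw [Algebra.smul_def, mul_smul]
    rfl⟩
  let d' : Derivation E L M :=
    { toFun := d
      map_add' := map_add d
      map_smul' := fun e x ↦ by
        rw [Algebra.smul_def, d.leibniz, hd, smul_zero, add_zero]
        rfl
      map_one_eq_zero' := d.map_one_eq_zero
      leibniz' := d.leibniz }
  have := Algebra.FormallyUnramified.of_isSeparable E L
  have := (Algebra.formallyUnramified_iff E L).mp this
  ext x
  change d' x = 0
  rw [← d'.liftKaehlerDifferential_comp_D, Subsingleton.elim (KaehlerDifferential.D E L x) 0, map_zero]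

theorem Derivation.eq_zero_of_isSeparable_adjoin {K L M : Type*} [Field K] [Field L] [Algebra K L]
    {S : Set L} [Algebra.IsSeparable (IntermediateField.adjoin K S) L] [AddCommGroup M] [Module L M]
    (d : Derivation ℤ L M) (hK : ∀ x : K, d (algebraMap K L x) = 0) (hS : ∀ x ∈ S, d x = 0) :
    d = 0 := by
  refine d.eq_zero_of_isSeparable (E := IntermediateField.adjoin K S) fun x ↦ ?_
  obtain ⟨x, hx⟩ := x
  change d x = 0
  induction hx using IntermediateField.adjoin_induction with
  | mem x hx => exact hS x hx
  | algebraMap x => exact hK x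
  | add x y _ _ hx hy => rw [map_add, hx, hy, add_zero]
  | inv x _ hx => rw [d.leibniz_inv, hx, smul_zero]
  | mul x y _ _ hx hy => rw [d.leibniz, hx, hy, smul_zero, smul_zero, add_zero]

theorem Derivation.apply_eq_zero_of_mul {L M : Type*} [Field L] [AddCommGroup M] [Module L M]
    (d : Derivation ℤ L M) {a x : L} (ha : a ≠ 0) (hda : d a = 0) (h : d (a * x) = 0) : d x = 0 := by
  rw [d.leibniz, hda, smul_zero, add_zero] at h
  exact (smul_eq_zero.mp h).resolve_left ha

theorem exists_separating_transcendenceBasis {K L Kbar : Type*} [Field K] [Field L] [Algebra K L]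
    [Field Kbar] [Algebra K Kbar] [IsAlgClosed Kbar] [Algebra.EssFiniteType K L]
    (p : ℕ) (hp : p.Prime) [CharP K p] [IsReduced (Kbar ⊗[K] L)] :
    ∃ s : Finset L, IsTranscendenceBasis K ((↑) : s → L) ∧
      Algebra.IsSeparable (IntermediateField.adjoin K (s : Set L)) L := by
  have : ExpChar K p := .prime hp
  refine exists_isTranscendenceBasis_and_isSeparable_of_linearIndepOn_pow_of_essFiniteType p hp
    fun s hs ↦ ?_
  rw [linearIndepOn_finset_iff]
  intro f hf
  choose t ht using fun i : L ↦ IsAlgClosed.exists_pow_nat_eq (algebraMap K Kbar (f i)) hp.pos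
  have : ExpChar (Kbar ⊗[K] L) p := expChar_of_injective_algebraMap
    (FaithfulSMul.algebraMap_injective K (Kbar ⊗[K] L)) p
  have hsum : ∑ i ∈ s, t i ⊗ₜ[K] i = 0 := by
    refine pow_eq_zero_iff hp.ne_zero |>.mp ?_
    rw [sum_pow_char]
    simp only [Algebra.TensorProduct.tmul_pow, ht, Algebra.algebraMap_eq_smul_one,
      TensorProduct.smul_tmul]
    rw [← TensorProduct.tmul_sum, hf, TensorProduct.tmul_zero]
  have hli := Module.Flat.linearIndependent_one_tmul (S := Kbar) hs
  intro i hi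
  have h0 : t i = 0 := by
    have := Fintype.linearIndependent_iff.mp hli (fun i ↦ t i) ?_ ⟨i, hi⟩
    · exact this
    · simp only [TensorProduct.smul_tmul', smul_eq_mul, mul_one, id]
      rw [← hsum]
      exact Finset.sum_coe_sort s fun i ↦ t i ⊗ₜ[K] i
  have := ht i
  rw [h0, zero_pow hp.ne_zero] at this
  exact (map_eq_zero _).mp this.symm

theorem Derivation.eq_zero_of_isSeparable_adjoin_of_pow {R K B L M : Type*} [CommRing R] [Field K]
    [Algebra R K] [IsFractionRing R K] [CommRing B] [Algebra R B] [Field L] [Algebra B L]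
    [FaithfulSMul B L] [Algebra R L] [IsScalarTower R B L] [Algebra K L] [IsScalarTower R K L]
    (p : ℕ) [CharP L p] {ι : Type*} {z' : ι → L}
    [Algebra.IsSeparable (IntermediateField.adjoin K (Set.range z')) L] [AddCommGroup M] [Module L M]
    {b : B} (hb : b ≠ 0) {z : ι → B} (hz : ∀ i, algebraMap B L (z i) = algebraMap B L b ^ p * z' i)
    {y : ι → B} {π : B} (hπ : π ∈ Algebra.adjoin R (Set.range fun i ↦ y i ^ p)) (hπ0 : π ≠ 0)
    (d : Derivation ℤ L M)
    (hd : ∀ x ∈ Algebra.adjoin R (Set.range fun i ↦ y i ^ p + π ^ 2 * z i),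
      d (algebraMap B L x) = 0) : d = 0 := by
  have hinj := FaithfulSMul.algebraMap_injective B L
  have hpow (x : L) : d (x ^ p) = 0 := by
    rw [d.leibniz_pow, ← Nat.cast_smul_eq_nsmul L, CharP.cast_eq_zero, zero_smul]
  have hR (r : R) : d (algebraMap R L r) = 0 := by
    rw [IsScalarTower.algebraMap_apply R B L]
    exact hd _ (Subalgebra.algebraMap_mem _ r)
  have hw (x) (hx : x ∈ Algebra.adjoin R (Set.range fun i ↦ y i ^ p)) :
      d (algebraMap B L x) = 0 := by
    induction hx using Algebra.adjoin_induction with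
    | mem x hx => obtain ⟨i, rfl⟩ := hx; rw [map_pow, hpow]
    | algebraMap r => rw [← IsScalarTower.algebraMap_apply, hR]
    | add x y _ _ hx hy => rw [map_add, map_add, hx, hy, add_zero]
    | mul x y _ _ hx hy => rw [map_mul, d.leibniz, hx, hy, smul_zero, smul_zero, add_zero]
  refine d.eq_zero_of_isSeparable_adjoin (K := K) (S := Set.range z') (fun x ↦ ?_) ?_
  · obtain ⟨n, a, ha, rfl⟩ := IsFractionRing.div_surjective (A := R) x
    rw [div_eq_mul_inv, map_mul, d.leibniz, map_inv₀, d.leibniz_inv,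
      ← IsScalarTower.algebraMap_apply, ← IsScalarTower.algebraMap_apply, hR, hR]
    simp
  · rintro _ ⟨i, rfl⟩
    have hb' : algebraMap B L b ^ p ≠ 0 := pow_ne_zero _ ((map_ne_zero_iff _ hinj).mpr hb)
    have hπ' : algebraMap B L π ^ 2 ≠ 0 := pow_ne_zero _ ((map_ne_zero_iff _ hinj).mpr hπ0)
    have h := hd _ (Algebra.subset_adjoin ⟨i, rfl⟩)
    simp only [map_add, map_mul, map_pow, hpow, zero_add] at h
    have h2 : d (algebraMap B L (z i)) = 0 :=
      d.apply_eq_zero_of_mul hπ' (by rw [d.leibniz_pow, hw π hπ, smul_zero, smul_zero]) h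
    rw [hz] at h2
    exact d.apply_eq_zero_of_mul hb' (hpow _) h2

theorem trdeg_eq_of_isFractionRing.{u} (R K : Type*) (B L : Type u) [CommRing R] [IsDomain R]
    [Field K] [Algebra R K] [IsFractionRing R K] [CommRing B] [IsDomain B] [Algebra R B]
    [FaithfulSMul R B] [Field L] [Algebra B L] [IsFractionRing B L] [Algebra R L]
    [IsScalarTower R B L] [Algebra K L] [IsScalarTower R K L] :
    Algebra.trdeg K L = Algebra.trdeg R B := by
  have : FaithfulSMul B L := (faithfulSMul_iff_algebraMap_injective _ _).mpr (IsFractionRing.injective B L)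
  have : FaithfulSMul R K := (faithfulSMul_iff_algebraMap_injective _ _).mpr (IsFractionRing.injective R K)
  have := IsLocalization.isAlgebraic (R := R) (S := K) (nonZeroDivisors R)
  have := IsLocalization.isAlgebraic (R := B) (S := L) (nonZeroDivisors B)
  have h1 := trdeg_add_eq R B (A := L)
  have h2 := lift_trdeg_add_eq R K L
  rw [trdeg_eq_zero (R := B) (A := L), add_zero] at h1
  rw [trdeg_eq_zero (R := R) (A := K), Cardinal.lift_zero, zero_add] at h2
  rw [h1]
  exact Cardinal.lift_injective h2

theorem essFiniteType_of_isFractionRing {R B P E L : Type*} [CommRing R] [CommRing B] [CommRing P]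
    [CommRing E] [CommRing L] [Algebra R B] [Algebra.FiniteType R B] [Algebra B L]
    [IsFractionRing B L] [Algebra R L] [IsScalarTower R B L] [Algebra R P] [Algebra P L]
    [IsScalarTower R P L] [Algebra P E] [Algebra E L] [IsScalarTower P E L] :
    Algebra.EssFiniteType E L := by
  have := Algebra.EssFiniteType.of_isLocalization (S := L) (nonZeroDivisors B)
  have := Algebra.EssFiniteType.comp R B L
  have := Algebra.EssFiniteType.of_comp R P L
  exact Algebra.EssFiniteType.of_comp P E L

theorem isSeparable_of_forall_derivation {E L : Type*} [Field E] [Field L] [Algebra E L]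
    [Algebra.EssFiniteType E L]
    (h : ∀ d : Derivation ℤ L (Ω[L⁄E]), (∀ x : E, d (algebraMap E L x) = 0) → d = 0) :
    Algebra.IsSeparable E L := by
  have h0 : (KaehlerDifferential.D E L).restrictScalars ℤ = 0 :=
    h _ fun x ↦ (KaehlerDifferential.D E L).map_algebraMap x
  have : Algebra.FormallyUnramified E L := by
    rw [Algebra.formallyUnramified_iff, ← Submodule.subsingleton_iff L, ← subsingleton_iff_bot_eq_top,
      ← KaehlerDifferential.span_range_derivation, eq_comm, Submodule.span_eq_bot]
    rintro _ ⟨x, rfl⟩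
    exact DFunLike.congr_fun h0 x
  exact Algebra.FormallyUnramified.isSeparable E L

theorem finiteDimensional_of_isSeparable (E L : Type*) [Field E] [Field L] [Algebra E L]
    [Algebra.EssFiniteType E L] [Algebra.IsSeparable E L] : FiniteDimensional E L := by
  have := Algebra.FormallyUnramified.of_isSeparable E L
  exact Algebra.FormallyUnramified.finite_of_free E L

theorem exists_isSeparable_fractionRing_adjoin.{u} {R K Kbar : Type*} {B L : Type u} [CommRing R]
    [IsDomain R] [Field K] [Algebra R K] [IsFractionRing R K] [Field Kbar] [Algebra K Kbar]
    [IsAlgClosed Kbar] [CommRing B] [IsDomain B] [Algebra R B] [FaithfulSMul R B]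
    [Algebra.FiniteType R B] [Field L] [Algebra B L] [IsFractionRing B L] [Algebra R L]
    [IsScalarTower R B L] [Algebra K L] [IsScalarTower R K L] [IsReduced (Kbar ⊗[K] L)] :
    ∃ (n e : ℕ) (z : Fin n → B), 0 < e ∧ Algebra.trdeg R B = n ∧
      ∀ (y : Fin n → B) (π : B), π ∈ Algebra.adjoin R (Set.range fun i ↦ y i ^ e) → π ≠ 0 →
      ∀ (P : Subalgebra R B), P = Algebra.adjoin R (Set.range fun i ↦ y i ^ e + π ^ 2 * z i) →
      ∀ [Algebra.IsAlgebraic P B] [Algebra (FractionRing P) L] [IsScalarTower P (FractionRing P) L],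
        Algebra.IsSeparable (FractionRing P) L := by
  have hBL : FaithfulSMul B L :=
    (faithfulSMul_iff_algebraMap_injective _ _).mpr (IsFractionRing.injective B L)
  have htr := trdeg_eq_of_isFractionRing R K B L
  obtain ⟨p, hp⟩ := CharP.exists K
  obtain hp' | rfl := CharP.char_is_prime_or_zero K p
  · have : CharP L p := charP_of_injective_algebraMap (algebraMap K L).injective p
    have : Algebra.EssFiniteType K L :=
      essFiniteType_of_isFractionRing (R := R) (B := B) (P := R)
    obtain ⟨s, hs, hsep⟩ := exists_separating_transcendenceBasis (K := K) (L := L) (Kbar := Kbar) p hp'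
    let z' : Fin s.card → L := fun i ↦ (s.equivFin.symm i : L)
    have hz' : Set.range z' = s := by
      ext x
      constructor
      · rintro ⟨i, rfl⟩
        exact (s.equivFin.symm i).2
      · intro hx
        exact ⟨s.equivFin ⟨x, hx⟩, by simp [z']⟩
    obtain ⟨b, hb⟩ := IsLocalization.exist_integer_multiples_of_finite (nonZeroDivisors B) z'
    choose c hc using hb
    refine ⟨s.card, p, fun i ↦ b ^ (p - 1) * c i, hp'.pos, ?_, ?_⟩
    · rw [← htr, ← hs.cardinalMk_eq_trdeg]
      simp
    · intro y π hπ hπ0 P hP _ _ _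
      have : Algebra.EssFiniteType (FractionRing P) L :=
        essFiniteType_of_isFractionRing (R := R) (B := B) (P := P)
      have : Algebra.IsSeparable (IntermediateField.adjoin K (Set.range z')) L := by
        rw [hz']
        exact hsep
      refine isSeparable_of_forall_derivation fun d hd ↦ ?_
      refine d.eq_zero_of_isSeparable_adjoin_of_pow (R := R) (K := K) p (z' := z')
        (z := fun i ↦ (b : B) ^ (p - 1) * c i)
        (nonZeroDivisors.coe_ne_zero b) (fun i ↦ ?_) hπ hπ0 fun x hx ↦ ?_
      · have : p = p - 1 + 1 := (Nat.sub_add_cancel hp'.one_le).symm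
        rw [map_mul, hc, Algebra.smul_def, ← mul_assoc, map_pow, ← pow_succ, ← this]
      · rw [← hP] at hx
        rw [← hd (algebraMap P (FractionRing P) ⟨x, hx⟩), ← IsScalarTower.algebraMap_apply]
        rfl
  · obtain ⟨n, hn⟩ := Cardinal.lt_aleph0.mp (trdeg_lt_aleph0_of_finiteType (R := R) (S := B))
    refine ⟨n, 1, 0, one_pos, hn, ?_⟩
    intro y π hπ hπ0 P hP _ _ _
    have := IsLocalization.isAlgebraic (R := B) (S := L) (nonZeroDivisors B)
    have : Algebra.IsAlgebraic P L := Algebra.IsAlgebraic.trans P B L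
    have : Algebra.IsAlgebraic (FractionRing P) L :=
      (IsFractionRing.comap_isAlgebraic_iff (A := P) (K := FractionRing P) (C := L)).mp this
    have : CharZero K := CharP.charP_to_charZero K
    have : CharZero L := charZero_of_injective_algebraMap (algebraMap K L).injective
    have : CharZero (FractionRing P) := (algebraMap (FractionRing P) L).charZero
    infer_instance

theorem nontrivial_fiber_under {R B : Type*} [CommRing R] [CommRing B] [Algebra R B] (q : Ideal B)
    [q.IsPrime] : Nontrivial ((q.under R).Fiber B) := by
  rw [← PrimeSpectrum.nonempty_iff_nontrivial]
  exact ⟨PrimeSpectrum.preimageEquivFiber R B ⟨q.under R, inferInstance⟩ ⟨⟨q, inferInstance⟩, rfl⟩⟩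

theorem AlgebraicIndependent.isNoetherianRing_isIntegrallyClosed_adjoin {R B : Type*} [CommRing R]
    [IsDedekindDomain R] [CommRing B] [Algebra R B] {n : ℕ} {u : Fin n → B}
    (hu : AlgebraicIndependent R u) :
    IsNoetherianRing (Algebra.adjoin R (Set.range u)) ∧
      IsIntegrallyClosed (Algebra.adjoin R (Set.range u)) := by
  have := MvPolynomial.isIntegrallyClosed_fin (R := R) n
  exact ⟨isNoetherianRing_of_ringEquiv _ hu.aevalEquiv.toRingEquiv,
    IsIntegrallyClosed.of_equiv hu.aevalEquiv.toRingEquiv⟩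

theorem finite_integralClosure_of_isDomain.{u} {R K Kbar : Type*} {B L : Type u} [CommRing R]
    [IsDedekindDomain R] [Field K] [Algebra R K] [IsFractionRing R K] [Field Kbar]
    [Algebra K Kbar] [IsAlgClosed Kbar] [CommRing B] [IsDomain B] [Algebra R B] [FaithfulSMul R B]
    [Algebra.FiniteType R B] [Field L] [Algebra B L] [IsFractionRing B L] [Algebra R L]
    [IsScalarTower R B L] [Algebra K L] [IsScalarTower R K L] (hred : IsReduced (Kbar ⊗[K] L)) :
    Module.Finite B (integralClosure B L) := by
  have := Algebra.FiniteType.isNoetherianRing R B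
  have : FaithfulSMul B L :=
    (faithfulSMul_iff_algebraMap_injective _ _).mpr (IsFractionRing.injective B L)
  obtain ⟨n, e, z, he, hn, hsep⟩ := exists_isSeparable_fractionRing_adjoin
    (R := R) (K := K) (Kbar := Kbar) (B := B) (L := L)
  refine Module.Finite.of_forall_isMaximal_exists_pow_smul_mem fun q hq ↦ ?_
  obtain rfl | hq0 := eq_or_ne q ⊥
  · have hB : IsField B := Ring.isField_iff_maximal_bot.mpr hq
    refine ⟨1, by simp, ⊤, ?_, fun x ↦ ⟨0, trivial⟩⟩
    have hsurj : Function.Surjective (algebraMap B L) :=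
      IsFractionRing.surjective_iff_isField.mpr hB
    refine (Module.finite_def).mp (Module.Finite.of_surjective
      (Algebra.linearMap B (integralClosure B L)) fun x ↦ ?_)
    obtain ⟨b, hb⟩ := hsurj x
    exact ⟨b, Subtype.ext hb⟩
  · have := nontrivial_fiber_under (R := R) q
    obtain ⟨y, hy⟩ := exists_isIntegral_fiber_pow (B := B) (q.under R) he hn.le
    obtain ⟨π, hπ, hπ0, hqf⟩ := exists_quasiFiniteAt_adjoin (R := R) q (fun i ↦ y i ^ e) z hq0
    set u := fun i ↦ y i ^ e + π ^ 2 * z i with hu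
    have : Algebra.FiniteType (Algebra.adjoin R (Set.range u)) B :=
      Algebra.FiniteType.of_restrictScalars_finiteType R _ _
    have := isAlgebraic_of_quasiFiniteAt (P := Algebra.adjoin R (Set.range u)) q
    have hind : AlgebraicIndependent R u :=
      (Algebra.IsAlgebraic.isTranscendenceBasis_of_lift_le_trdeg_of_finite R u (by simp [hn])).1
    obtain ⟨_, _⟩ := hind.isNoetherianRing_isIntegrallyClosed_adjoin
    have : FaithfulSMul (Algebra.adjoin R (Set.range u)) L := FaithfulSMul.trans _ B L
    let _ := FractionRing.liftAlgebra (Algebra.adjoin R (Set.range u)) L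
    have := FractionRing.isScalarTower_liftAlgebra (Algebra.adjoin R (Set.range u)) L
    have := hsep y π hπ hπ0 _ rfl
    have : Algebra.EssFiniteType (FractionRing (Algebra.adjoin R (Set.range u))) L :=
      essFiniteType_of_isFractionRing (R := R) (B := B) (P := Algebra.adjoin R (Set.range u))
    have := finiteDimensional_of_isSeparable (FractionRing (Algebra.adjoin R (Set.range u))) L
    exact exists_fg_of_quasiFiniteAt (P := Algebra.adjoin R (Set.range u)) q

theorem isReduced_tensorProduct_of_isLocalization {R S A B : Type*} [CommRing R] [CommRing S]
    [CommRing A] [CommRing B] [Algebra R S] [Algebra R A] [Algebra R B] [Algebra A B]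
    [IsScalarTower R A B] (M : Submonoid A) [IsLocalization M B] [IsReduced (S ⊗[R] A)] :
    IsReduced (S ⊗[R] B) := by
  let f := Algebra.TensorProduct.map (AlgHom.id S S) (IsScalarTower.toAlgHom R A B)
  let _ : Algebra (S ⊗[R] A) (S ⊗[R] B) := f.toRingHom.toAlgebra
  have : IsScalarTower S (S ⊗[R] A) (S ⊗[R] B) := .of_algebraMap_eq fun x ↦ (f.commutes x).symm
  have := IsLocalization.tensorProduct_tensorProduct_right R S M B <| by
    ext a
    change f (1 ⊗ₜ a) = 1 ⊗ₜ algebraMap A B a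
    simp [f]
  let N := M.map (Algebra.TensorProduct.includeRight (R := R) (A := S) (B := A))
  exact isReduced_of_injective (IsLocalization.algEquiv N (S ⊗[R] B) (Localization N))
    (AlgEquiv.injective _)

theorem bijective_algebraMap_residueField_of_mem_minimalPrimes {A : Type*} [CommRing A] [IsReduced A]
    (P : Ideal A) [P.IsPrime] (hP : P ∈ minimalPrimes A) :
    Function.Bijective (algebraMap (Localization.AtPrime P) P.ResidueField) := by
  have := IsLocalization.subsingleton_primeSpectrum_of_mem_minimalPrimes P hP (Localization.AtPrime P)
  let _ := (PrimeSpectrum.subsingleton_iff_isField_of_isReduced.mp this).toField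
  exact ⟨(algebraMap (Localization.AtPrime P) P.ResidueField).injective,
    IsLocalRing.residue_surjective⟩

theorem isReduced_tensorProduct_residueField {R S A : Type*} [CommRing R] [CommRing S]
    [CommRing A] [Algebra R S] [Algebra R A] [IsReduced A] [IsReduced (S ⊗[R] A)]
    (P : Ideal A) [P.IsPrime] (hP : P ∈ minimalPrimes A) : IsReduced (S ⊗[R] P.ResidueField) := by
  have := isReduced_tensorProduct_of_isLocalization (R := R) (S := S) (B := Localization.AtPrime P)
    P.primeCompl
  let e : Localization.AtPrime P ≃ₐ[R] P.ResidueField :=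
    AlgEquiv.ofBijective (IsScalarTower.toAlgHom R (Localization.AtPrime P) P.ResidueField)
      (bijective_algebraMap_residueField_of_mem_minimalPrimes P hP)
  exact isReduced_of_injective (Algebra.TensorProduct.congr (AlgEquiv.refl (R := R) (A₁ := S)) e.symm)
    (AlgEquiv.injective _)

theorem finite_integralClosure_fractionRing {A : Type*} [CommRing A] [IsNoetherianRing A]
    [IsReduced A]
    (h : ∀ P : minimalPrimes A, ∀ [P.1.IsPrime],
      Module.Finite (A ⧸ P.1) (integralClosure (A ⧸ P.1) P.1.ResidueField)) :
    Module.Finite A (integralClosure A (FractionRing A)) := by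
  have hprime (P : minimalPrimes A) : P.1.IsPrime := P.2.1.1
  have hunit (P : minimalPrimes A) (s : nonZeroDivisors A) :
      IsUnit (Algebra.ofId A P.1.ResidueField s) :=
    isUnit_iff_ne_zero.mpr fun h0 ↦ notMem_nonZeroDivisors_of_mem_mem_minimalPrimes
      (Ideal.algebraMap_residueField_eq_zero.mp h0) P.2 s.2
  let φ (P : minimalPrimes A) : FractionRing A →ₐ[A] P.1.ResidueField :=
    IsLocalization.liftAlgHom (M := nonZeroDivisors A) (hunit P)
  have hφ (x : FractionRing A) (hx : ∀ P, φ P x = 0) : x = 0 := by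
    obtain ⟨a, s, rfl⟩ := IsLocalization.exists_mk'_eq (nonZeroDivisors A) x
    suffices a = 0 by rw [this, IsLocalization.mk'_zero]
    have : a ∈ sInf (minimalPrimes A) := by
      refine Ideal.mem_sInf.mpr fun {P} hP ↦ ?_
      have := hprime ⟨P, hP⟩
      rw [← Ideal.algebraMap_residueField_eq_zero, ← (φ ⟨P, hP⟩).commutes,
        ← IsLocalization.mk'_spec (FractionRing A) a s, map_mul, hx, zero_mul]
    rw [minimalPrimes, Ideal.sInf_minimalPrimes] at this
    exact (mem_nilradical.mp this).eq_zero
  have := minimalPrimes.finite_of_isNoetherianRing A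
  have : Finite (minimalPrimes A) := this
  have (P : minimalPrimes A) : Module.Finite A (integralClosure (A ⧸ P.1) P.1.ResidueField) :=
    have := h P
    .trans (A ⧸ P.1) _
  let Φ : integralClosure A (FractionRing A) →ₗ[A]
      ∀ P : minimalPrimes A, integralClosure (A ⧸ P.1) P.1.ResidueField :=
    { toFun := fun x P ↦ ⟨φ P x, (x.2.map (φ P)).tower_top⟩
      map_add' := fun x y ↦ funext fun P ↦ Subtype.ext (map_add (φ P) _ _)
      map_smul' := fun a x ↦ funext fun P ↦ Subtype.ext (map_smul (φ P) a x.1) }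
  refine Module.Finite.of_injective Φ ((injective_iff_map_eq_zero Φ).mpr fun x hx ↦ ?_)
  exact Subtype.ext (hφ x fun P ↦ congr_arg Subtype.val (congr_fun hx P))

theorem faithfulSMul_quotient_of_mem_minimalPrimes {R A : Type*} [CommRing R] [IsDomain R]
    [CommRing A] [Algebra R A] [Module.Flat R A] {P : Ideal A} (hP : P ∈ minimalPrimes A) :
    FaithfulSMul R (A ⧸ P) := by
  rw [faithfulSMul_iff_algebraMap_injective, injective_iff_map_eq_zero]
  intro r hr
  by_contra hr0
  rw [IsScalarTower.algebraMap_apply R A, Ideal.Quotient.algebraMap_eq,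
    Ideal.Quotient.eq_zero_iff_mem] at hr
  refine notMem_nonZeroDivisors_of_mem_mem_minimalPrimes hr hP ?_
  rw [mem_nonZeroDivisors_iff_right]
  intro a ha
  rw [mul_comm, ← Algebra.smul_def] at ha
  exact (smul_eq_zero.mp ha).resolve_left hr0

/-- If `A` is a finitely generated flat algebra over a Dedekind
domain `R` whose generic fiber is geometrically reduced (i.e. `K̄ ⊗_R A` is
reduced for an algebraic closure `K̄` of `K = Frac R`), then `A` is reduced and
the integral closure of `A` in its total ring of fractions is a finitely
generated `A`-module. -/
theorem stmt_15 (R K Kbar A : Type*) [CommRing R] [IsDomain R] [IsDedekindDomain R]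
    [Field K] [Algebra R K] [IsFractionRing R K]
    [Field Kbar] [Algebra K Kbar] [IsAlgClosure K Kbar]
    [Algebra R Kbar] [IsScalarTower R K Kbar]
    [CommRing A] [Algebra R A] [Algebra.FiniteType R A] [Module.Flat R A]
    (hred : IsReduced (Kbar ⊗[R] A)) :
    IsReduced A ∧ Module.Finite A (integralClosure A (FractionRing A)) := by
  have hA : IsReduced A := isReduced_of_injective
    (Algebra.TensorProduct.includeRight : A →ₐ[R] Kbar ⊗[R] A) <|
    Algebra.TensorProduct.includeRight_injective <| by
      rw [IsScalarTower.algebraMap_eq R K Kbar]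
      exact (algebraMap K Kbar).injective.comp (IsFractionRing.injective R K)
  have := Algebra.FiniteType.isNoetherianRing R A
  have : IsAlgClosed Kbar := IsAlgClosure.isAlgClosed K
  refine ⟨hA, finite_integralClosure_fractionRing fun P _ ↦ ?_⟩
  have := faithfulSMul_quotient_of_mem_minimalPrimes (R := R) P.2
  have := isReduced_tensorProduct_residueField (R := R) (S := Kbar) P.1 P.2
  have hinj : Function.Injective (algebraMap R P.1.ResidueField) := by
    rw [IsScalarTower.algebraMap_eq R (A ⧸ P.1)]
    exact (IsFractionRing.injective (A ⧸ P.1) P.1.ResidueField).comp (FaithfulSMul.algebraMap_injective R (A ⧸ P.1))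
  let _ : Algebra K P.1.ResidueField := (IsFractionRing.lift hinj).toAlgebra
  have : IsScalarTower R K P.1.ResidueField :=
    .of_algebraMap_eq fun x ↦ (IsFractionRing.lift_algebraMap hinj x).symm
  have : IsReduced (Kbar ⊗[K] P.1.ResidueField) :=
    isReduced_of_injective
      (IsLocalization.algebraTensorEquiv (nonZeroDivisors R) K Kbar P.1.ResidueField)
      (AlgEquiv.injective _)
  have : Algebra.FiniteType R (A ⧸ P.1) := .trans (S := A) ‹_› inferInstance
  exact finite_integralClosure_of_isDomain (R := R) (K := K) (Kbar := Kbar) ‹_›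
end
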